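/- Let q be an even positive integer and let n, l be odd integers. If q ≡ 0 (mod 4), then K(n,l;q) = 0. If q ≡ 2 (mod 4), write r = q/2 (which is odd); then K(n,l;q) = 2·q·χ₄(r)·S(c·n², c·l²; r), where c is any integer with 8·c ≡ 1 (mod r) and S denotes the Kloosterman sum. -/

import Mathlib

open Complex Real MeasureTheory Filter Finset

noncomputable section

/-- The nontrivial Dirichlet character mod 4, extended to `ℤ`, valued in `ℂ`. -/
def chi4 (m : ℤ) : ℂ := if m % 4 = 1 then 1 else if m % 4 = 3 then -1 else 0

/-- `σ_s(χ₄; n) = ∑_{d ∣ n} χ₄(d) d^s`. -/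
def sigmaChi4 (s : ℂ) (n : ℕ) : ℂ := ∑ d ∈ n.divisors, chi4 d * (d : ℂ) ^ s

/-- `σ'_s(χ₄; n) = ∑_{d ∣ n} χ₄(d) d^s log d`. -/
def sigmaChi4' (s : ℂ) (n : ℕ) : ℂ := ∑ d ∈ n.divisors, chi4 d * (d : ℂ) ^ s * (Real.log d : ℂ)

/-- `e(x) = exp(2πix)`. -/
def e2pi (x : ℂ) : ℂ := Complex.exp (2 * (Real.pi : ℂ) * Complex.I * x)

/-- The Dirichlet L-function of the nontrivial character mod 4. -/
def Lchi4 (s : ℂ) : ℂ :=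
  DirichletCharacter.LFunction (ZMod.χ₄.ringHomComp (Int.castRingHom ℂ)) s

/-- Generalized quadratic Gauss sum `G(a, n; q)`. -/
def Gsum (a n : ℤ) (q : ℕ) : ℂ :=
  ∑ x ∈ Finset.range q, e2pi (((a * (x : ℤ) ^ 2 + n * (x : ℤ) : ℤ) : ℂ) / (q : ℂ))

/-- `K(n, l; q) = ∑_{a b ≡ 1 (mod q)} G(a,n;q) G(b,l;q)`. -/
def Ksum (n l : ℤ) (q : ℕ) : ℂ :=
  ∑ a ∈ Finset.range q, ∑ b ∈ Finset.range q,
    if (a * b) % q = 1 % q then Gsum a n q * Gsum b l q else 0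

/-- Kloosterman sum `S(m, n; c)`. -/
def kloosterman (m n : ℤ) (c : ℕ) : ℂ :=
  ∑ x ∈ Finset.range c,
    if Nat.gcd x c = 1 then
      e2pi (((m * (x : ℤ) + n * ((((x : ZMod c)⁻¹).val : ℕ) : ℤ) : ℤ) : ℂ) / (c : ℂ))
    else 0

/-- Ramanujan sum `c_C(m)`. -/
def ramanujanSum (C : ℕ) (m : ℤ) : ℂ :=
  ∑ D ∈ Finset.range C,
    if Nat.gcd D C = 1 then e2pi (((m * (D : ℤ) : ℤ) : ℂ) / (C : ℂ)) else 0

/-- Gauss sum `g(χ₄; q; m)`. -/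
def gaussChi4 (q : ℕ) (m : ℤ) : ℂ :=
  ∑ u ∈ Finset.range q,
    if Nat.gcd u q = 1 then chi4 u * e2pi (((m * (u : ℤ) : ℤ) : ℂ) / (q : ℂ)) else 0

end

section helpers

lemma e2pi_zmod (N : ℕ) [NeZero N] (j : ℤ) :
    e2pi ((j : ℂ) / (N : ℂ)) = ZMod.stdAddChar (j : ZMod N) := by
  rw [ZMod.stdAddChar_coe, e2pi]
  congr 1
  ring

lemma sum_range_zmod (N : ℕ) [NeZero N] (f : ZMod N → ℂ) :
    ∑ x ∈ Finset.range N, f (x : ZMod N) = ∑ x : ZMod N, f x := by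
  obtain ⟨m, rfl⟩ := Nat.exists_eq_succ_of_ne_zero (NeZero.ne N)
  rw [Finset.sum_range]
  apply Finset.sum_congr rfl
  intro x _
  congr 1
  exact Fin.cast_val_eq_self x

lemma sum_units_eq (N : ℕ) [NeZero N] (f : ZMod N → ZMod N → ℂ) :
    ∑ a : ZMod N, ∑ b : ZMod N, (if a * b = 1 then f a b else 0)
      = ∑ u : (ZMod N)ˣ, f u (u⁻¹ : (ZMod N)ˣ) := by
  rw [← Fintype.sum_prod_type', ← Finset.sum_filter]
  symm
  refine Finset.sum_bij (fun u _ => ((u : ZMod N), ((u⁻¹ : (ZMod N)ˣ) : ZMod N))) ?_ ?_ ?_ ?_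
  · intro u _; simp
  · intro u _ v _ h
    exact Units.ext (Prod.ext_iff.mp h).1
  · rintro ⟨a, b⟩ h
    have h' : a * b = 1 := by simpa using h
    exact ⟨⟨a, b, h', by rw [mul_comm]; exact h'⟩, Finset.mem_univ _, rfl⟩
  · intro u _; rfl

lemma sum_isUnit_eq (N : ℕ) [NeZero N] (f : ZMod N → ℂ) :
    ∑ a : ZMod N, (if IsUnit a then f a else 0) = ∑ u : (ZMod N)ˣ, f u := by
  classical
  rw [← Finset.sum_filter]
  symm
  refine Finset.sum_bij (fun u _ => (u : ZMod N)) ?_ ?_ ?_ ?_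
  · intro u _; simp
  · intro u _ v _ h
    exact Units.ext h
  · intro a h
    obtain ⟨u, hu⟩ : IsUnit a := by simpa using h
    exact ⟨u, Finset.mem_univ _, hu⟩
  · intro u _; rfl

lemma kloosterman_zmod (m n : ℤ) (N : ℕ) [NeZero N] :
    kloosterman m n N = ∑ u : (ZMod N)ˣ,
      ZMod.stdAddChar ((m : ZMod N) * (u : ZMod N) + (n : ZMod N) * ((u⁻¹ : (ZMod N)ˣ) : ZMod N)) := by
  classical
  have h := sum_isUnit_eq N (fun a => ZMod.stdAddChar ((m : ZMod N) * a + (n : ZMod N) * a⁻¹))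
  simp only [ZMod.inv_coe_unit] at h
  rw [← h, ← sum_range_zmod, kloosterman]
  apply Finset.sum_congr rfl
  intro x _
  rw [e2pi_zmod]
  simp only [ZMod.isUnit_iff_coprime, Nat.Coprime]
  congr 2
  push_cast
  rw [ZMod.natCast_zmod_val]

lemma Gsum_zmod (a n : ℤ) (N : ℕ) [NeZero N] :
    Gsum a n N = ∑ x : ZMod N, ZMod.stdAddChar ((a : ZMod N) * x ^ 2 + (n : ZMod N) * x) := by
  rw [← sum_range_zmod, Gsum]
  apply Finset.sum_congr rfl
  intro x _
  rw [e2pi_zmod]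
  push_cast
  rfl

/-- quadratic Gauss sum -/
noncomputable def gq (N : ℕ) [NeZero N] (t : ZMod N) : ℂ := ∑ x : ZMod N, ZMod.stdAddChar (t * x ^ 2)

lemma gq_mul_neg (N : ℕ) [NeZero N] (h2 : IsUnit (2 : ZMod N)) (t : ZMod N) (ht : IsUnit t) :
    gq N t * gq N (-t) = N := by
  classical
  have h1 : gq N t * gq N (-t) = ∑ y : ZMod N, ∑ z : ZMod N,
      ZMod.stdAddChar (t * z ^ 2) * ZMod.stdAddChar (y * (2 * t * z)) := by
    rw [gq, gq, Finset.sum_mul_sum, Finset.sum_comm]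
    apply Finset.sum_congr rfl
    intro y _
    rw [← Equiv.sum_comp (Equiv.addLeft y)]
    apply Finset.sum_congr rfl
    intro z _
    rw [← AddChar.map_add_eq_mul, ← AddChar.map_add_eq_mul]
    congr 1
    simp only [Equiv.coe_addLeft]
    ring
  rw [h1, Finset.sum_comm]
  simp_rw [← Finset.mul_sum, AddChar.sum_mulShift _ (ZMod.isPrimitive_stdAddChar N),
    (h2.mul ht).mul_right_eq_zero]
  simp [ZMod.card]

lemma exists_neg_one (N : ℕ) [NeZero N] (hN : Odd N) :
    ∃ u v : ZMod N, u ^ 2 + v ^ 2 = -1 := by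
  have : NeZero (4 * N) := ⟨by have := NeZero.ne N; omega⟩
  have hpos := NeZero.pos N
  have hu : IsUnit (((2 * N - 1 : ℕ)) : ZMod (4 * N)) := by
    rw [ZMod.isUnit_iff_coprime]
    apply Nat.Coprime.mul_right
    · rw [show 4 = 2 ^ 2 by norm_num]
      apply Nat.Coprime.pow_right
      rw [Nat.coprime_two_right]
      exact ⟨N - 1, by omega⟩
    · apply Nat.coprime_of_dvd
      intro k hk h1 h2
      have h3 : k ∣ 2 * N := h2.mul_left 2
      have : k ∣ 1 := by
        have := (Nat.dvd_sub h3 h1)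
        rwa [show 2 * N - (2 * N - 1) = 1 by omega] at this
      exact hk.one_lt.ne' (Nat.dvd_one.mp this)
  obtain ⟨p, -, hp, hpe⟩ := Nat.forall_exists_prime_gt_and_eq_mod hu 0
  rw [ZMod.natCast_eq_natCast_iff] at hpe
  have := Fact.mk hp
  have h4 : p % 4 = (2 * N - 1) % 4 := hpe.of_mul_right N
  have hN' : p ≡ 2 * N - 1 [MOD N] := hpe.of_mul_left 4
  obtain ⟨a, b, hab⟩ := Nat.Prime.sq_add_sq (p := p) (by obtain ⟨k, rfl⟩ := hN; omega)
  refine ⟨a, b, ?_⟩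
  rw [← ZMod.natCast_eq_natCast_iff, ← hab, Nat.cast_sub (by omega)] at hN'
  push_cast at hN'
  rw [hN']
  simp

lemma gq_sq_neg (N : ℕ) [NeZero N] (hN : Odd N) (t : ZMod N) :
    gq N t ^ 2 = gq N (-t) ^ 2 := by
  obtain ⟨u, v, huv⟩ := exists_neg_one N hN
  have key : ∀ s : ZMod N, gq N s ^ 2 = ∑ p : ZMod N × ZMod N,
      ZMod.stdAddChar (s * (p.1 ^ 2 + p.2 ^ 2)) := by
    intro s
    rw [sq, gq, Finset.sum_mul_sum, Fintype.sum_prod_type]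
    simp_rw [← AddChar.map_add_eq_mul, mul_add]
  rw [key, key]
  let E : ZMod N × ZMod N ≃ ZMod N × ZMod N :=
    { toFun := fun p => (u * p.1 - v * p.2, v * p.1 + u * p.2)
      invFun := fun p => (-(u * p.1 + v * p.2), -(-v * p.1 + u * p.2))
      left_inv := by
        rintro ⟨x, y⟩
        ext
        · simp only; linear_combination (-x) * huv
        · simp only; linear_combination (-y) * huv
      right_inv := by
        rintro ⟨x, y⟩
        ext
        · simp only; linear_combination (-x) * huv
        · simp only; linear_combination (-y) * huv }
  rw [← Equiv.sum_comp E]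
  apply Finset.sum_congr rfl
  rintro ⟨x, y⟩ _
  congr 1
  simp only [E, Equiv.coe_fn_mk]
  linear_combination (t * (x ^ 2 + y ^ 2)) * huv

lemma gq_integral (N : ℕ) [NeZero N] (hN : Odd N) (t : ZMod N) :
    ∃ A : ℂ, IsIntegral ℤ A ∧ gq N t = 1 + 2 * A := by
  obtain ⟨m, hm⟩ := hN
  refine ⟨∑ i ∈ Finset.range m, ZMod.stdAddChar (t * ((i : ZMod N) + 1) ^ 2), ?_, ?_⟩
  · apply IsIntegral.sum
    intro i _
    apply IsIntegral.of_pow (NeZero.pos N)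
    rw [← AddChar.map_nsmul_eq_pow]
    simp [isIntegral_one]
  · rw [gq, ← sum_range_zmod]
    have : Finset.range N = Finset.range (m + m + 1) := by rw [hm, two_mul]
    rw [this, Finset.sum_range_succ', Finset.sum_range_add,
      ← Finset.sum_range_reflect (fun x => ZMod.stdAddChar (t * (((m + x + 1 : ℕ) : ZMod N)) ^ 2))]
    have h : ∀ j ∈ Finset.range m,
        ZMod.stdAddChar (t * (((m + (m - 1 - j) + 1 : ℕ) : ZMod N)) ^ 2)
        = (ZMod.stdAddChar (t * ((j : ZMod N) + 1) ^ 2) : ℂ) := by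
      intro j hj
      rw [Finset.mem_range] at hj
      have : ((m + (m - 1 - j) + 1 : ℕ) : ZMod N) = -((j : ZMod N) + 1) := by
        rw [eq_neg_iff_add_eq_zero]
        have h0 : ((m + (m - 1 - j) + 1 + (j + 1) : ℕ) : ZMod N) = 0 := by
          rw [show m + (m - 1 - j) + 1 + (j + 1) = N by omega]
          simp
        simpa using h0
      rw [this, neg_sq]
    rw [Finset.sum_congr rfl h]
    simp
    ring

lemma gq_sq (N : ℕ) [NeZero N] (hN : Odd N) (t : ZMod N) (ht : IsUnit t) :
    gq N t ^ 2 = chi4 (N : ℤ) * N := by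
  have h2 : IsUnit (2 : ZMod N) := by
    have := (ZMod.isUnit_iff_coprime 2 N).mpr (Nat.coprime_two_left.mpr hN)
    simpa using this
  have h1 := gq_mul_neg N h2 t ht
  have h3 := gq_sq_neg N hN t
  obtain ⟨A, hA, hgA⟩ := gq_integral N hN t
  have h4 : (gq N t ^ 2 - N) * (gq N t ^ 2 + N) = 0 := by
    rw [← h1]
    linear_combination (gq N t ^ 2) * h3
  have hB : IsIntegral ℤ (A + A ^ 2) := hA.add (hA.pow 2)
  have hint : ∀ s : ℤ, gq N t ^ 2 = s → s % 4 = 1 := by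
    intro s hs
    have e : A + A ^ 2 = algebraMap ℚ ℂ (((s : ℚ) - 1) / 4) := by
      rw [hgA] at hs
      simp
      linear_combination hs / 4
    rw [e, isIntegral_algebraMap_iff (algebraMap ℚ ℂ).injective,
      IsIntegrallyClosed.isIntegral_iff] at hB
    obtain ⟨k, hk⟩ := hB
    have : (s : ℚ) = 4 * k + 1 := by
      simp at hk
      linear_combination -4 * hk
    have : s = 4 * k + 1 := by exact_mod_cast this
    omega
  have hmod : (N : ℤ) % 4 = 1 ∨ (N : ℤ) % 4 = 3 := by
    obtain ⟨k, rfl⟩ := hN; omega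
  rcases mul_eq_zero.mp h4 with h | h
  · have h5 : gq N t ^ 2 = ((N : ℤ) : ℂ) := by push_cast; linear_combination h
    have := hint _ h5
    rw [h5, chi4, if_pos this]; simp
  · have h5 : gq N t ^ 2 = ((-N : ℤ) : ℂ) := by push_cast; linear_combination h
    have := hint _ h5
    rw [h5, chi4, if_neg (by omega), if_pos (by omega)]; simp



lemma Gsum_zero (k : ℕ) (hk : 0 < k) (a n : ℤ) (hn : Odd n) : Gsum a n (4 * k) = 0 := by
  have : NeZero (4 * k) := ⟨by omega⟩
  rw [Gsum_zmod]
  have h4 : (4 * k : ZMod (4 * k)) = 0 := by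
    have := ZMod.natCast_self (4 * k)
    push_cast at this
    exact this
  obtain ⟨j, rfl⟩ := hn
  have hne : (ZMod.stdAddChar ((2 * k : ℕ) : ZMod (4 * k)) : ℂ) ≠ 1 := by
    intro h
    rw [← (ZMod.stdAddChar (N := 4 * k)).map_zero_eq_one, ZMod.injective_stdAddChar.eq_iff,
      ZMod.natCast_eq_zero_iff] at h
    have := Nat.le_of_dvd (by omega) h
    omega
  set S := ∑ x : ZMod (4 * k), (ZMod.stdAddChar ((a : ZMod (4 * k)) * x ^ 2
    + ((2 * j + 1 : ℤ) : ZMod (4 * k)) * x) : ℂ) with hS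
  have h : S = S * ZMod.stdAddChar ((2 * k : ℕ) : ZMod (4 * k)) := by
    rw [hS, Finset.sum_mul]
    conv_lhs => rw [← Equiv.sum_comp (Equiv.addRight ((2 * k : ℕ) : ZMod (4 * k)))]
    apply Finset.sum_congr rfl
    intro x _
    rw [← AddChar.map_add_eq_mul]
    congr 1
    simp only [Equiv.coe_addRight]
    push_cast
    linear_combination (a * x + a * k + j) * h4
  have h' : S * (ZMod.stdAddChar ((2 * k : ℕ) : ZMod (4 * k)) - 1) = 0 := by
    linear_combination -h
  rcases mul_eq_zero.mp h' with h | h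
  · exact h
  · exact absurd (sub_eq_zero.mp h) hne

lemma Gsum_half (r : ℕ) [NeZero r] (a n : ℤ) (ha : Odd a) (hn : Odd n)
    (b c : ZMod r) (hc : 8 * c = 1) (hab : (a : ZMod r) * b = 1) :
    Gsum a n (2 * r) = 2 * ZMod.stdAddChar (-c * b * (n : ZMod r) ^ 2) * gq r (4 * c * a) := by
  have h1 : ∀ x : ℕ, e2pi (((a * (x : ℤ) ^ 2 + n * (x : ℤ) : ℤ) : ℂ) / ((2 * r : ℕ) : ℂ))
      = ZMod.stdAddChar (4 * c * ((a : ZMod r) * (x : ZMod r) ^ 2 + (n : ZMod r) * (x : ZMod r))) := by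
    intro x
    have hev : Even (a * (x : ℤ) ^ 2 + n * (x : ℤ)) := by
      rcases Int.even_or_odd (x : ℤ) with h | h
      · exact (((h.pow_of_ne_zero two_ne_zero)).mul_left a).add (h.mul_left n)
      · exact (ha.mul h.pow).add_odd (hn.mul h)
    obtain ⟨k, hk⟩ := hev
    have hk' : (a : ZMod r) * (x : ZMod r) ^ 2 + (n : ZMod r) * (x : ZMod r) = k + k := by
      have := congrArg (fun z : ℤ => (z : ZMod r)) hk
      push_cast at this
      exact this
    rw [hk, hk', show 4 * c * ((k : ZMod r) + k) = k by linear_combination (k : ZMod r) * hc,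
      ← e2pi_zmod]
    congr 1
    have : (r : ℂ) ≠ 0 := by exact_mod_cast NeZero.ne r
    push_cast
    field_simp
    ring
  rw [Gsum, Finset.sum_congr rfl (fun x _ => h1 x), two_mul r, Finset.sum_range_add]
  simp only [Nat.cast_add, ZMod.natCast_self, zero_add]
  rw [sum_range_zmod r (fun x => ZMod.stdAddChar (4 * c * ((a : ZMod r) * x ^ 2 + (n : ZMod r) * x))),
    ← two_mul, mul_assoc]
  congr 1
  rw [gq, Finset.mul_sum]
  rw [← Equiv.sum_comp (Equiv.addRight (4 * c * (n : ZMod r) * b))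
    (fun x => ZMod.stdAddChar (-c * b * (n : ZMod r) ^ 2) * ZMod.stdAddChar (4 * c * (a : ZMod r) * x ^ 2))]
  apply Finset.sum_congr rfl
  intro x _
  rw [← AddChar.map_add_eq_mul]
  congr 1
  simp only [Equiv.coe_addRight]
  have e : (8 * c - 1) = 0 := by rw [hc]; ring
  generalize (n : ZMod r) = N at *
  generalize (a : ZMod r) = a at *
  linear_combination (-(4 * c * N * x) * (8 * c) - 64 * c ^ 3 * N ^ 2 * b) * hab
    + (-(4 * c * N * x) - (8 * c + 1) * c * N ^ 2 * b) * hc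

lemma gq_inv (r : ℕ) [NeZero r] (s a b : ZMod r) (hab : a * b = 1) :
    gq r (s * b) = gq r (s * a) := by
  let E : ZMod r ≃ ZMod r :=
    { toFun := fun x => a * x
      invFun := fun x => b * x
      left_inv := fun x => by linear_combination x * hab
      right_inv := fun x => by linear_combination x * hab }
  rw [gq, ← Equiv.sum_comp E, gq]
  apply Finset.sum_congr rfl
  intro x _
  congr 1
  simp only [E, Equiv.coe_fn_mk]
  linear_combination (s * a * x ^ 2) * hab

lemma sum_units_half (r : ℕ) [NeZero r] (hr : Odd r) (F : (ZMod r)ˣ → ℂ) :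
    have : NeZero (2 * r) := ⟨by have := NeZero.ne r; omega⟩
    ∑ u : (ZMod (2 * r))ˣ, F (ZMod.unitsMap (Dvd.intro_left 2 rfl) u) = ∑ v : (ZMod r)ˣ, F v := by
  intro this
  apply Function.Bijective.sum_comp (e := ZMod.unitsMap (Dvd.intro_left 2 rfl : r ∣ 2 * r))
  rw [Fintype.bijective_iff_surjective_and_card]
  refine ⟨ZMod.unitsMap_surjective _, ?_⟩
  rw [ZMod.card_units_eq_totient, ZMod.card_units_eq_totient, Nat.totient_two_mul_of_odd hr]

lemma Ksum_half (r : ℕ) [NeZero r] (hr : Odd r) (n l c : ℤ) (hn : Odd n) (hl : Odd l)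
    (hc : (8 * c : ZMod r) = 1) :
    Ksum n l (2 * r) = 4 * (r : ℂ) * chi4 r * kloosterman (c * n ^ 2) (c * l ^ 2) r := by
  have : NeZero (2 * r) := ⟨by have := NeZero.ne r; omega⟩
  have hdvd : r ∣ 2 * r := Dvd.intro_left 2 rfl
  let pr := ZMod.castHom hdvd (ZMod r)
  let f : ZMod (2 * r) → ZMod (2 * r) → ℂ := fun a b => 4 * (r : ℂ) * chi4 r *
    ZMod.stdAddChar (-(c : ZMod r) * (pr b * (n : ZMod r) ^ 2 + pr a * (l : ZMod r) ^ 2))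
  have h1 : Ksum n l (2 * r) = ∑ a : ZMod (2 * r), ∑ b : ZMod (2 * r),
      (if a * b = 1 then f a b else 0) := by
    rw [← sum_range_zmod, Ksum]
    apply Finset.sum_congr rfl
    intro a _
    rw [← sum_range_zmod (2 * r) (fun b => if (a : ZMod (2 * r)) * b = 1 then f a b else 0)]
    apply Finset.sum_congr rfl
    intro b _
    have hiff : (a * b) % (2 * r) = 1 % (2 * r) ↔
        (a : ZMod (2 * r)) * (b : ZMod (2 * r)) = 1 := by
      have := ZMod.natCast_eq_natCast_iff' (a * b) 1 (2 * r)
      push_cast at this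
      exact this.symm
    by_cases h : (a : ZMod (2 * r)) * (b : ZMod (2 * r)) = 1
    · have h' := hiff.mpr h
      rw [if_pos h, if_pos h']
      have hodd : Odd (a * b) := by
        have h'' : a * b ≡ 1 [MOD 2] := Nat.ModEq.of_mul_right r h'
        exact Nat.odd_iff.mpr h''
      have hao : Odd (a : ℤ) := by exact_mod_cast (Nat.odd_mul.mp hodd).1
      have hbo : Odd (b : ℤ) := by exact_mod_cast (Nat.odd_mul.mp hodd).2
      have hab : (a : ZMod r) * (b : ZMod r) = 1 := by
        have := congrArg pr h
        simpa [pr] using this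
      rw [Gsum_half r a n hao hn (b : ZMod r) c hc (by simpa using hab),
        Gsum_half r b l hbo hl (a : ZMod r) c hc (by rw [mul_comm]; simpa using hab)]
      simp only [Int.cast_natCast, f, pr, map_natCast]
      rw [gq_inv r (4 * c) a b hab]
      have hu : IsUnit (4 * (c : ZMod r) * a) := by
        apply IsUnit.of_mul_eq_one (2 * (b : ZMod r))
        linear_combination hc + 8 * (c : ZMod r) * hab
      have hg := gq_sq r hr _ hu
      have hψ : (ZMod.stdAddChar (-(c : ZMod r) * ((b : ZMod r) * (n : ZMod r) ^ 2
          + (a : ZMod r) * (l : ZMod r) ^ 2)) : ℂ) =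
          ZMod.stdAddChar (-(c : ZMod r) * (b : ZMod r) * (n : ZMod r) ^ 2) *
          ZMod.stdAddChar (-(c : ZMod r) * (a : ZMod r) * (l : ZMod r) ^ 2) := by
        rw [← AddChar.map_add_eq_mul]
        congr 1
        ring
      rw [hψ]
      linear_combination 4 * ZMod.stdAddChar (-(c : ZMod r) * (b : ZMod r) * (n : ZMod r) ^ 2) *
          ZMod.stdAddChar (-(c : ZMod r) * (a : ZMod r) * (l : ZMod r) ^ 2) * hg
    · rw [if_neg h, if_neg (fun h' => h (hiff.mp h'))]
  rw [h1, sum_units_eq, kloosterman_zmod, Finset.mul_sum]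
  have h2 := sum_units_half r hr (fun v => 4 * (r : ℂ) * chi4 r *
    ZMod.stdAddChar (-(c : ZMod r) * (((v⁻¹ : (ZMod r)ˣ) : ZMod r) * (n : ZMod r) ^ 2
      + (v : ZMod r) * (l : ZMod r) ^ 2)))
  refine Eq.trans ?_ (h2.trans ?_)
  · apply Finset.sum_congr rfl
    intro u _
    rw [← map_inv]
    rfl
  · rw [← Equiv.sum_comp ((Equiv.neg (ZMod r)ˣ).trans (Equiv.inv (ZMod r)ˣ))]
    apply Finset.sum_congr rfl
    intro u _
    congr 2
    simp only [Equiv.trans_apply, Equiv.neg_apply, Equiv.inv_apply, inv_neg, Units.val_neg,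
      inv_inv]
    push_cast
    ring

end helpers

/-- `K(n,l;q)` for `q` even and `n`, `l` odd. -/
theorem Ksum_q_even_n_l_odd (q : ℕ) (hq : 0 < q) (hqe : Even q) (n l : ℤ)
    (hn : Odd n) (hl : Odd l) :
    (q % 4 = 0 → Ksum n l q = 0) ∧
    (q % 4 = 2 → ∀ c : ℤ, 8 * c ≡ 1 [ZMOD ((q / 2 : ℕ) : ℤ)] →
      Ksum n l q = 2 * (q : ℂ) * chi4 ((q / 2 : ℕ) : ℤ) *
        kloosterman (c * n ^ 2) (c * l ^ 2) (q / 2)) := by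
  refine ⟨fun h => ?_, fun h c hc => ?_⟩
  · obtain ⟨k, rfl⟩ : 4 ∣ q := Nat.dvd_of_mod_eq_zero h
    rw [Ksum]
    apply Finset.sum_eq_zero
    intro a _
    apply Finset.sum_eq_zero
    intro b _
    rw [Gsum_zero k (by omega) a n hn]
    simp
  · obtain ⟨r, rfl⟩ : 2 ∣ q := hqe.two_dvd
    have : NeZero r := ⟨by omega⟩
    rw [Nat.mul_div_cancel_left r two_pos] at hc ⊢
    have hr : Odd r := by rw [Nat.odd_iff]; omega
    have hc' : (8 * c : ZMod r) = 1 := by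
      have := (ZMod.intCast_eq_intCast_iff _ _ _).mpr hc
      push_cast at this
      exact this
    rw [Ksum_half r hr n l c hn hl hc']
    push_cast
    ring
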